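/- Let F be a differential field of characteristic zero with field of constants C, let f₁, f₂ ∈ F satisfy condition (C), let r ∈ F, and let F ⊆ E be an extension of differential fields with E = F(x₁, x₂, y), where x₁, x₂, y are algebraically independent over F and x₁′ = f₁, x₂′ = f₂, y′ = f₁·x₂ + r. If x ∈ E satisfies x′ ∈ F, then there exist constants c₁, c₂ ∈ C and an element s ∈ F such that x = c₁·x₁ + c₂·x₂ + s. -/

import Mathlib

open Polynomial Differential

section PrimitiveExtension

variable {K : Type*} [Field K]

lemma exists_isCoprime_monic_aeval_div {E : Type*} [Field E] [Algebra K E] {t : E}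
    (ht : Transcendental K t) {z : E} (hz : z ∈ IntermediateField.adjoin K {t}) :
    ∃ p q : K[X], IsCoprime p q ∧ q.Monic ∧ z * aeval t q = aeval t p := by
  obtain ⟨p, q, rfl⟩ := (IntermediateField.mem_adjoin_simple_iff K z).1 hz
  rcases eq_or_ne q 0 with rfl | hq
  · exact ⟨0, 1, isCoprime_one_right, monic_one, by simp⟩
  let _ := UniqueFactorizationMonoid.toGCDMonoid K[X]
  obtain ⟨p', q', hp', hq', hu⟩ := extract_gcd p q
  generalize gcd p q = g at hp' hq'
  subst hp' hq'
  have hq0 : q' ≠ 0 := right_ne_zero_of_mul hq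
  have hl : IsUnit (C q'.leadingCoeff⁻¹) :=
    isUnit_C.2 (inv_ne_zero (leadingCoeff_ne_zero.2 hq0)).isUnit
  have hgt : aeval t g ≠ 0 := fun h ↦ left_ne_zero_of_mul hq (transcendental_iff.1 ht _ h)
  have hqt : aeval t q' ≠ 0 := fun h ↦ hq0 (transcendental_iff.1 ht _ h)
  refine ⟨p' * C q'.leadingCoeff⁻¹, q' * C q'.leadingCoeff⁻¹,
    (isCoprime_mul_unit_right hl _ _).2 ((gcd_isUnit_iff _ _).1 hu),
    monic_mul_leadingCoeff_inv hq0, ?_⟩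
  simp only [map_mul]
  field_simp

variable [Differential K]

lemma coeff_implicitDeriv_C (a : K) (p : K[X]) (i : ℕ) :
    (implicitDeriv (C a) p).coeff i = (p.coeff i)′ + a * (p.coeff (i + 1) * (i + 1)) := by
  simp [implicitDeriv, coeff_derivative]

lemma degree_implicitDeriv_C_lt_of_monic (a : K) {q : K[X]} (hq : q.Monic) :
    (implicitDeriv (C a) q).degree < q.degree := by
  rw [degree_eq_natDegree hq.ne_zero, degree_lt_iff_coeff_zero]
  intro m hm
  rw [coeff_implicitDeriv_C, coeff_eq_zero_of_natDegree_lt (show q.natDegree < m + 1 by omega)]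
  rcases hm.eq_or_lt with rfl | hlt
  · simp [hq.coeff_natDegree]
  · simp [coeff_eq_zero_of_natDegree_lt hlt]

variable [CharZero K] {a : K} (ha : ∀ g : K, g′ ≠ a)
include ha

lemma deriv_add_mul_natCast_ne_zero {c g : K} (hc : c ≠ 0) (hc' : c′ = 0) {n : ℕ} (hn : n ≠ 0) :
    g′ + a * (c * n) ≠ 0 := by
  intro h
  have hn' : (n : K) ≠ 0 := Nat.cast_ne_zero.2 hn
  have hcn : (c * n)′ = 0 := by simp [hc']
  refine ha (-g / (c * n)) ?_
  rw [Derivation.leibniz_div, hcn]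
  have : g′ = -(a * (c * n)) := eq_neg_of_add_eq_zero_left h
  simp only [map_neg, this, smul_eq_mul]
  field_simp
  simp

lemma eq_one_of_monic_dvd_implicitDeriv {q : K[X]} (hq : q.Monic)
    (hdvd : q ∣ implicitDeriv (C a) q) : q = 1 := by
  by_contra hne
  have hn : q.natDegree ≠ 0 := fun h ↦ hne (hq.natDegree_eq_zero.1 h)
  have h0 := eq_zero_of_dvd_of_degree_lt hdvd (degree_implicitDeriv_C_lt_of_monic a hq)
  have h1 := congrArg (coeff · (q.natDegree - 1)) h0
  obtain ⟨m, hm⟩ := Nat.exists_eq_succ_of_ne_zero hn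
  have hlead : q.coeff (m + 1) = 1 := by rw [← Nat.succ_eq_add_one, ← hm]; exact hq.coeff_natDegree
  simp only [hm, Nat.succ_eq_add_one, Nat.add_sub_cancel, coeff_implicitDeriv_C, hlead,
    coeff_zero] at h1
  exact deriv_add_mul_natCast_ne_zero ha one_ne_zero (by simp) m.succ_ne_zero (by exact_mod_cast h1)

lemma natDegree_le_two_of_implicitDeriv_eq {p : K[X]} {u v : K}
    (h : implicitDeriv (C a) p = C u * X + C v) : p.natDegree ≤ 2 := by
  by_contra! hlt
  obtain ⟨m, hm⟩ := Nat.exists_eq_add_of_lt hlt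
  have hp : p ≠ 0 := by rintro rfl; simp at hlt
  have hc : p.coeff (m + 3) ≠ 0 := by
    rw [show m + 3 = p.natDegree by omega]; simpa using hp
  have h3 := congrArg (coeff · (m + 3)) h
  have h2 := congrArg (coeff · (m + 2)) h
  simp only [coeff_implicitDeriv_C, coeff_add, coeff_C_mul, coeff_X, coeff_C,
    coeff_eq_zero_of_natDegree_lt (show p.natDegree < m + 3 + 1 by omega)] at h2 h3
  refine deriv_add_mul_natCast_ne_zero ha (g := p.coeff (m + 2)) hc (by simpa using h3)
    (Nat.succ_ne_zero (m + 2)) ?_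
  simpa using h2

/-- If the antiderivative `t` of `a` is transcendental over `K` and `a` has no antiderivative in
`K`, then an antiderivative in `K(t)` of a linear polynomial in `t` is a quadratic polynomial. -/
lemma exists_quadratic_of_deriv_eq_linear {E : Type*} [Field E] [Differential E] [Algebra K E]
    [DifferentialAlgebra K E] {t : E} (ht : Transcendental K t) (hta : t′ = algebraMap K E a)
    {z : E} (hz : z ∈ IntermediateField.adjoin K {t}) {u v : K}
    (hz' : z′ = algebraMap K E u * t + algebraMap K E v) :
    ∃ α β γ : K, z = algebraMap K E α * t ^ 2 + algebraMap K E β * t + algebraMap K E γ ∧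
      α′ = 0 ∧ β′ + 2 * α * a = u ∧ γ′ + β * a = v := by
  obtain ⟨p, q, hpq, hq, hzq⟩ := exists_isCoprime_monic_aeval_div ht hz
  have hinj := transcendental_iff_injective.1 ht
  have hδ := deriv_aeval_eq_implicitDeriv t (C a) (by simpa using hta)
  have hlin : z′ = aeval t (C u * X + C v) := by simpa using hz'
  have key : p * implicitDeriv (C a) q + q * (q * (C u * X + C v)) =
      q * implicitDeriv (C a) p := by
    apply hinj
    have := congrArg Differential.deriv hzq
    rw [Derivation.leibniz, hδ, hδ, hlin] at this
    simp only [smul_eq_mul] at this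
    rw [map_add, map_mul, map_mul, map_mul, map_mul, ← hzq, ← this]
    ring
  have hdvd : q ∣ implicitDeriv (C a) q := by
    refine hpq.symm.dvd_of_dvd_mul_left
      ((dvd_add_left (dvd_mul_right q (q * (C u * X + C v)))).1 ?_)
    rw [key]
    exact dvd_mul_right q _
  obtain rfl := eq_one_of_monic_dvd_implicitDeriv ha hq hdvd
  have hp : implicitDeriv (C a) p = C u * X + C v := by simpa using key.symm
  have hdeg := natDegree_le_two_of_implicitDeriv_eq ha hp
  have h0 := congrArg (coeff · 0) hp
  have h1 := congrArg (coeff · 1) hp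
  have h2 := congrArg (coeff · 2) hp
  simp only [coeff_implicitDeriv_C, coeff_add, coeff_C_mul, coeff_X, coeff_C,
    coeff_eq_zero_of_natDegree_lt (show p.natDegree < 2 + 1 by omega)] at h0 h1 h2
  norm_num at h0 h1 h2
  refine ⟨p.coeff 2, p.coeff 1, p.coeff 0, ?_, h2, by rw [← h1]; ring, by rw [← h0]; ring⟩
  rw [map_one, mul_one] at hzq
  rw [hzq, aeval_eq_sum_range' (show p.natDegree < 3 by omega)]
  simp only [Finset.sum_range_succ, Finset.sum_range_zero, Algebra.smul_def]
  ring

end PrimitiveExtension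

section SubfieldExtension

variable {E : Type*} [Field E]

open scoped IntermediateField.algebraAdjoinAdjoin in
lemma transcendental_closure_of_algebraicIndependent {F : Subfield E} {ι : Type*} {x : ι → E}
    (hx : AlgebraicIndependent F x) {s : Set ι} {i : ι} (hi : i ∉ s) :
    Transcendental (Subfield.closure (F ∪ x '' s)) (x i) := by
  have h := hx.transcendental_adjoin hi
  have h' : Transcendental (IntermediateField.adjoin F (x '' s)) (x i) := fun halg ↦
    h ((IsFractionRing.isAlgebraic_iff _ _ _).2 halg)
  have heq : Subfield.closure (F ∪ x '' s) =
      (IntermediateField.adjoin F (x '' s)).toSubfield := by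
    have hrange : Set.range (algebraMap F E) = F := Subtype.range_coe
    rw [← hrange]
    rfl
  rw [heq]
  exact h'

variable [CharZero E] (D : Derivation ℚ E E)

lemma deriv_mem_closure_insert {K : Subfield E} (hK : ∀ b ∈ K, D b ∈ K) {t : E} (ht : D t ∈ K)
    {b : E} (hb : b ∈ Subfield.closure (insert t (K : Set E))) :
    D b ∈ Subfield.closure (insert t (K : Set E)) := by
  have hsub : ∀ w ∈ K, w ∈ Subfield.closure (insert t (K : Set E)) := fun w hw ↦
    Subfield.subset_closure (Set.mem_insert_of_mem _ hw)
  induction hb using Subfield.closure_induction with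
  | mem w hw =>
    rcases hw with rfl | hw
    · exact hsub _ ht
    · exact hsub _ (hK w hw)
  | one => simp [zero_mem]
  | add v w _ _ hv hw => rw [map_add]; exact add_mem hv hw
  | neg w _ hw => rw [map_neg]; exact neg_mem hw
  | inv w hw hw' =>
    rw [Derivation.leibniz_inv, smul_eq_mul]
    exact mul_mem (neg_mem (pow_mem (inv_mem hw) 2)) hw'
  | mul v w hv hw hv' hw' =>
    rw [Derivation.leibniz, smul_eq_mul, smul_eq_mul]
    exact add_mem (mul_mem hv hw') (mul_mem hw hv')

variable {D} {K : Subfield E} (hK : ∀ b ∈ K, D b ∈ K) {t : E}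
  (ht : Transcendental K t) (hta : D t ∈ K) (ha : ∀ g ∈ K, D g ≠ D t)
include hK ht hta ha

lemma exists_quadratic_of_mem_closure {z u v : E}
    (hz : z ∈ Subfield.closure (insert t (K : Set E))) (hu : u ∈ K) (hv : v ∈ K)
    (hz' : D z = u * t + v) :
    ∃ α ∈ K, ∃ β ∈ K, ∃ γ ∈ K, z = α * t ^ 2 + β * t + γ ∧
      D α = 0 ∧ D β + 2 * α * D t = u ∧ D γ + β * D t = v := by
  let _ : Differential E := ⟨D.restrictScalars ℤ⟩
  let _ : Differential K := ⟨Derivation.mk'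
    { toFun := fun b ↦ ⟨D b, hK b b.2⟩
      map_add' := fun b c ↦ Subtype.ext (map_add D (b : E) c)
      map_smul' := fun n b ↦ Subtype.ext (map_zsmul D n (b : E)) }
    fun b c ↦ Subtype.ext (D.leibniz b c)⟩
  have _ : DifferentialAlgebra K E := ⟨fun _ ↦ rfl⟩
  have hmem : z ∈ IntermediateField.adjoin K {t} := by
    refine (?_ : Subfield.closure (insert t (K : Set E)) ≤
      (IntermediateField.adjoin K {t}).toSubfield) hz
    rw [Subfield.closure_le]
    rintro w (rfl | hw)
    · exact IntermediateField.mem_adjoin_simple_self K w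
    · exact (IntermediateField.adjoin K {t}).algebraMap_mem ⟨w, hw⟩
  obtain ⟨α, β, γ, hzq, hα, hβ, hγ⟩ := exists_quadratic_of_deriv_eq_linear (K := K)
    (a := ⟨D t, hta⟩) (fun g hg ↦ ha g g.2 (congrArg Subtype.val hg)) ht rfl hmem
    (u := ⟨u, hu⟩) (v := ⟨v, hv⟩) hz'
  exact ⟨α, α.2, β, β.2, γ, γ.2, hzq, congrArg Subtype.val hα, congrArg Subtype.val hβ,
    congrArg Subtype.val hγ⟩

lemma exists_linear_of_mem_closure {z : E}
    (hz : z ∈ Subfield.closure (insert t (K : Set E))) (hz' : D z ∈ K) :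
    ∃ c ∈ K, ∃ s ∈ K, D c = 0 ∧ z = c * t + s := by
  obtain ⟨α, hα, β, hβ, γ, hγ, hzq, hα', hβ', -⟩ :=
    exists_quadratic_of_mem_closure hK ht hta ha hz K.zero_mem hz' (by ring)
  have h0 : α = 0 := by
    by_contra hne
    refine ha (-β / (2 * α)) (div_mem (neg_mem hβ) (mul_mem (ofNat_mem K 2) hα)) ?_
    have h2 : D (2 * α) = 0 := by rw [two_mul, map_add, hα', add_zero]
    rw [Derivation.leibniz_div, h2, map_neg, eq_neg_of_add_eq_zero_left hβ']
    simp only [smul_eq_mul]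
    field_simp
    simp
  subst h0
  exact ⟨β, hβ, γ, hγ, by simpa using hβ', by simpa using hzq⟩

end SubfieldExtension

/-- With `E = F(x₁, x₂, y)` as in Statement 7 (`f₁, f₂` satisfying
condition (C), `x₁′ = f₁`, `x₂′ = f₂`, `y′ = f₁·x₂ + r`), every `x ∈ E` with `x′ ∈ F` has
the form `x = c₁·x₁ + c₂·x₂ + s` with `c₁, c₂` constants of `F` and `s ∈ F`. -/
theorem antiderivative_form_heisenberg
    (E : Type) [Field E] [CharZero E] (D : Derivation ℚ E E)
    (F : Subfield E) (hF : ∀ a ∈ F, D a ∈ F)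
    (f₁ f₂ r : E) (hf₁ : f₁ ∈ F) (hf₂ : f₂ ∈ F) (hr : r ∈ F)
    (hcondC : ∀ c₁ c₂ g : E, c₁ ∈ F → D c₁ = 0 → c₂ ∈ F → D c₂ = 0 → g ∈ F →
      c₁ * f₁ + c₂ * f₂ = D g → c₁ = 0 ∧ c₂ = 0)
    (x₁ x₂ y : E) (hind : AlgebraicIndependent F ![x₁, x₂, y])
    (h1 : D x₁ = f₁) (h2 : D x₂ = f₂) (h3 : D y = f₁ * x₂ + r)
    (hgen : Subfield.closure (↑F ∪ {x₁, x₂, y}) = ⊤)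
    (ξ : E) (hξ : D ξ ∈ F) :
    ∃ c₁ c₂ s : E, c₁ ∈ F ∧ D c₁ = 0 ∧ c₂ ∈ F ∧ D c₂ = 0 ∧ s ∈ F ∧
      ξ = c₁ * x₁ + c₂ * x₂ + s := by
  subst h1 h2
  have hx₂ : Transcendental F x₂ := hind.transcendental 1
  have hD₂ : ∀ g ∈ F, D g ≠ D x₂ := fun g hg h ↦ one_ne_zero
    (hcondC 0 1 g F.zero_mem (map_zero D) F.one_mem D.map_one_eq_zero hg (by rw [h]; ring)).2
  set K := Subfield.closure (insert x₂ (F : Set E))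
  have hFK : ∀ b ∈ F, b ∈ K := fun b hb ↦ Subfield.subset_closure (Set.mem_insert_of_mem _ hb)
  have hK : ∀ b ∈ K, D b ∈ K := fun b hb ↦ deriv_mem_closure_insert D hF hf₂ hb
  have hx₁ : Transcendental K x₁ := by
    have := transcendental_closure_of_algebraicIndependent hind (s := {1}) (i := 0) (by simp)
    rwa [Set.image_singleton, Set.union_singleton] at this
  have hD₁ : ∀ g ∈ K, D g ≠ D x₁ := by
    intro g hg h
    obtain ⟨c, hc, s, hs, hc', rfl⟩ := exists_linear_of_mem_closure hF hx₂ hf₂ hD₂ hg (h ▸ hf₁)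
    refine one_ne_zero (hcondC 1 (-c) s F.one_mem D.map_one_eq_zero (neg_mem hc) (by simp [hc'])
      hs ?_).1
    rw [← h]
    simp [hc']
  set L := Subfield.closure (insert x₁ (K : Set E))
  have hKL : ∀ b ∈ K, b ∈ L := fun b hb ↦ Subfield.subset_closure (Set.mem_insert_of_mem _ hb)
  have hx₂K : x₂ ∈ K := Subfield.subset_closure (Set.mem_insert _ _)
  have hx₁L : x₁ ∈ L := Subfield.subset_closure (Set.mem_insert _ _)
  have hL : ∀ b ∈ L, D b ∈ L := fun b hb ↦ deriv_mem_closure_insert D hK (hFK _ hf₁) hb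
  -- Constants of `K` already lie in `F`.
  have hconstK : ∀ c ∈ K, D c = 0 → c ∈ F := by
    intro c hc hc'
    obtain ⟨b, hb, s, hs, hb', rfl⟩ :=
      exists_linear_of_mem_closure hF hx₂ hf₂ hD₂ hc (hc' ▸ F.zero_mem)
    have hb0 : b = 0 := (hcondC 0 b (-s) F.zero_mem (map_zero D) hb hb' (neg_mem hs) (by
      simp [hb'] at hc'
      rw [map_neg]
      linear_combination hc')).2
    simpa [hb0] using hs
  -- An antiderivative in `L` of an element of `F` has the required form.
  have hformL : ∀ z ∈ L, D z ∈ F → ∃ c₁ c₂ s : E, c₁ ∈ F ∧ D c₁ = 0 ∧ c₂ ∈ F ∧ D c₂ = 0 ∧ s ∈ F ∧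
      z = c₁ * x₁ + c₂ * x₂ + s := by
    intro z hz hz'
    obtain ⟨c, hc, s, hs, hc', rfl⟩ :=
      exists_linear_of_mem_closure hK hx₁ (hFK _ hf₁) hD₁ hz (hFK _ hz')
    have hcF := hconstK c hc hc'
    have hs' : D s ∈ F := by
      have : D s = D (c * x₁ + s) - c * D x₁ := by simp [hc']
      rw [this]
      exact sub_mem hz' (mul_mem hcF hf₁)
    obtain ⟨b, hb, w, hw, hb', rfl⟩ := exists_linear_of_mem_closure hF hx₂ hf₂ hD₂ hs hs'
    exact ⟨c, b, w, hcF, hc', hb, hb', hw, by ring⟩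
  -- `c * f₁ * x₂ + v` has no antiderivative in `L` unless `c = 0`.
  have hnoL : ∀ z ∈ L, ∀ c ∈ F, D c = 0 → ∀ v ∈ F, D z = c * D x₁ * x₂ + v → c = 0 := by
    intro z hz c hc hc' v hv hzv
    obtain ⟨b, hb, s, hs, hb', rfl⟩ := exists_linear_of_mem_closure hK hx₁ (hFK _ hf₁) hD₁ hz
      (hzv ▸ add_mem (mul_mem (hFK _ (mul_mem hc hf₁)) hx₂K) (hFK _ hv))
    have hbF := hconstK b hb hb'
    have hs' : D s = c * D x₁ * x₂ + (v - b * D x₁) := by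
      have : D s = D (b * x₁ + s) - b * D x₁ := by simp [hb']
      rw [this, hzv]
      ring
    obtain ⟨α, hα, β, hβ, γ, -, -, hα', hβ', -⟩ := exists_quadratic_of_mem_closure hF hx₂ hf₂ hD₂ hs
      (mul_mem hc hf₁) (sub_mem hv (mul_mem hbF hf₁)) hs'
    refine (hcondC c (-(2 * α)) β hc hc' (neg_mem (mul_mem (ofNat_mem F 2) hα))
      (by simp [two_mul, hα']) hβ ?_).1
    rw [← hβ']
    ring
  have hy : Transcendental L y := by
    have := transcendental_closure_of_algebraicIndependent hind (s := {0, 1}) (i := 2) (by simp)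
    have hle : L ≤ Subfield.closure (F ∪ ![x₁, x₂, y] '' {0, 1}) := by
      rw [Subfield.closure_le, Set.insert_subset_iff, SetLike.coe_subset_coe, Subfield.closure_le,
        Set.insert_subset_iff]
      exact ⟨Subfield.subset_closure (Or.inr ⟨0, by simp⟩),
        Subfield.subset_closure (Or.inr ⟨1, by simp⟩), fun b hb ↦
        Subfield.subset_closure (Or.inl hb)⟩
    have hge : Subfield.closure (F ∪ ![x₁, x₂, y] '' {0, 1}) ≤ L := by
      simp only [Subfield.closure_le, Set.image_pair]
      rintro b (hb | rfl | rfl)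
      exacts [hKL _ (hFK _ hb), hx₁L, hKL _ hx₂K]
    rwa [le_antisymm hge hle] at this
  have hyL : D y ∈ L := by
    rw [h3]
    exact hKL _ (add_mem (mul_mem (hFK _ hf₁) hx₂K) (hFK _ hr))
  have hDy : ∀ g ∈ L, D g ≠ D y := fun g hg h ↦ one_ne_zero
    (hnoL g hg 1 F.one_mem D.map_one_eq_zero r hr (by rw [h, h3]; ring))
  have hξL : ξ ∈ Subfield.closure (insert y (L : Set E)) := by
    refine (?_ : Subfield.closure (↑F ∪ {x₁, x₂, y}) ≤ _) (hgen ▸ Subfield.mem_top ξ)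
    rw [Subfield.closure_le]
    rintro b (hb | rfl | rfl | rfl)
    · exact Subfield.subset_closure (Or.inr (hKL _ (hFK _ hb)))
    · exact Subfield.subset_closure (Or.inr hx₁L)
    · exact Subfield.subset_closure (Or.inr (hKL _ hx₂K))
    · exact Subfield.subset_closure (Or.inl rfl)
  obtain ⟨c, hc, s, hs, hc', rfl⟩ :=
    exists_linear_of_mem_closure hL hy hyL hDy hξL (hKL _ (hFK _ hξ))
  have hcF : c ∈ F := by
    obtain ⟨c₁, c₂, w, hc₁, hc₁', hc₂, hc₂', hw, rfl⟩ := hformL c hc (hc' ▸ F.zero_mem)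
    obtain ⟨rfl, rfl⟩ := hcondC c₁ c₂ (-w) hc₁ hc₁' hc₂ hc₂' (neg_mem hw) (by
      simp [hc₁', hc₂'] at hc'
      rw [map_neg, ← add_eq_zero_iff_eq_neg, ← hc'])
    simpa using hw
  have hs' : D s = -c * D x₁ * x₂ + (D (c * y + s) - c * r) := by
    simp [hc', h3]
    ring
  have hc0 : c = 0 := neg_eq_zero.1 (hnoL s hs (-c) (neg_mem hcF) (by simp [hc']) _
    (sub_mem hξ (mul_mem hcF hr)) hs')
  subst hc0
  simpa using hformL s hs (by simpa using hξ)
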